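/- (Correctness of the occupancy state query for a voxel off the boundary map.) Let occ : ℤ³ → S be an occupancy map, let e be an axis direction, let q ∈ ℤ³, and let r ≥ 1 be an integer. Assume that the voxel q + r·e is a boundary voxel and that for every integer i with 0 ≤ i < r the voxel q + i·e is not a boundary voxel. Then occ(q) ≠ occupied, and moreover occ(q) = free if and only if occ(q + r·e) = free (equivalently, if and only if q + r·e is a boundary interior voxel); in all other cases occ(q) = unknown. -/

import Mathlib

inductive OccState : Type
  | free | occupied | unknown
deriving DecidableEq

abbrev Voxel := ℤ × ℤ × ℤ

/-- Two voxels are 6-neighbors iff their ℓ¹ distance is 1. -/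
def sixNbr (m n : Voxel) : Prop :=
  |m.1 - n.1| + |m.2.1 - n.2.1| + |m.2.2 - n.2.2| = 1

/-- Boundary interior voxel: free, with a 6-neighbor that is unknown or occupied. -/
def bdInt (occ : Voxel → OccState) (n : Voxel) : Prop :=
  occ n = OccState.free ∧
    ∃ m, sixNbr m n ∧ (occ m = OccState.unknown ∨ occ m = OccState.occupied)

/-- Boundary exterior (unknown) voxel: unknown, with a free 6-neighbor. -/
def bdUkn (occ : Voxel → OccState) (n : Voxel) : Prop :=
  occ n = OccState.unknown ∧ ∃ m, sixNbr m n ∧ occ m = OccState.free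

/-- Boundary exterior (occupied) voxel: any occupied voxel. -/
def bdOcc (occ : Voxel → OccState) (n : Voxel) : Prop :=
  occ n = OccState.occupied

/-- Boundary voxel. -/
def bdVoxel (occ : Voxel → OccState) (n : Voxel) : Prop :=
  bdInt occ n ∨ bdUkn occ n ∨ bdOcc occ n

/-- An axis direction: exactly one nonzero coordinate, equal to ±1 (ℓ¹ norm 1). -/
def axisDir (e : Voxel) : Prop :=
  |e.1| + |e.2.1| + |e.2.2| = 1

theorem sixNbr_add_succ_smul {e : Voxel} (he : axisDir e) (q : Voxel) (i : ℤ) :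
    sixNbr (q + (i + 1) • e) (q + i • e) := by
  have h : q + (i + 1) • e = q + i • e + e := by rw [add_smul, one_smul, add_assoc]
  rw [h]
  simpa [sixNbr, axisDir] using he

/-- A voxel off the boundary map is free exactly when any given 6-neighbor is. -/
theorem free_iff_of_not_bdVoxel {occ : Voxel → OccState} {m n : Voxel}
    (hmn : sixNbr m n) (hn : ¬ bdVoxel occ n) :
    occ n = OccState.free ↔ occ m = OccState.free := by
  constructor
  · intro h
    cases hm : occ m with
    | free => rfl
    | occupied => exact (hn (Or.inl ⟨h, m, hmn, Or.inr hm⟩)).elim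
    | unknown => exact (hn (Or.inl ⟨h, m, hmn, Or.inl hm⟩)).elim
  · intro h
    cases h' : occ n with
    | free => rfl
    | occupied => exact (hn (Or.inr (Or.inr h'))).elim
    | unknown => exact (hn (Or.inr (Or.inl ⟨h', m, hmn, h⟩))).elim

/-- Freeness is constant along a ray whose voxels before the end are off the boundary map. -/
theorem free_iff_of_ray {occ : Voxel → OccState} {e : Voxel} (he : axisDir e) (q : Voxel) {r : ℤ}
    (hr : 0 ≤ r) (hnb : ∀ i : ℤ, 0 ≤ i → i < r → ¬ bdVoxel occ (q + i • e)) :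
    occ q = OccState.free ↔ occ (q + r • e) = OccState.free := by
  induction r, hr using Int.leInduction with
  | base => simp
  | succ k hk ih =>
    rw [ih fun i h0 hi => hnb i h0 (by omega)]
    exact free_iff_of_not_bdVoxel (sixNbr_add_succ_smul he q k) (hnb k hk (by omega))

theorem stmt4 (occ : Voxel → OccState) (e : Voxel) (he : axisDir e)
    (q : Voxel) (r : ℤ) (hr : 1 ≤ r)
    (hb : bdVoxel occ (q + r • e))
    (hnb : ∀ i : ℤ, 0 ≤ i → i < r → ¬ bdVoxel occ (q + i • e)) :
    occ q ≠ OccState.occupied ∧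
    (occ q = OccState.free ↔ occ (q + r • e) = OccState.free) ∧
    (occ q = OccState.free ↔ bdInt occ (q + r • e)) ∧
    (occ q ≠ OccState.free → occ q = OccState.unknown) := by
  have hocc : occ q ≠ OccState.occupied := fun h =>
    hnb 0 le_rfl (by omega) (Or.inr (Or.inr (by simpa [bdOcc] using h)))
  have hfree := free_iff_of_ray he q (by omega) hnb
  refine ⟨hocc, hfree, hfree.trans ⟨fun h => ?_, fun h => h.1⟩, fun h => ?_⟩
  · rcases hb with hb | hb | hb
    · exact hb
    · exact absurd (h.symm.trans hb.1) (by decide)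
    · exact absurd (h.symm.trans hb) (by decide)
  · cases h' : occ q with
    | free => exact absurd h' h
    | occupied => exact absurd h' hocc
    | unknown => rfl
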